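/- Let Q and Q′ be normal coordinates for germs at 0 of real-analytic hypersurfaces M, M′ ⊂ ℂ², neither Levi-flat near 0. Then there exists a holomorphic function Ψ(χ, Λ, Λ̃) defined on a neighborhood of {0} × T(ℂ²) × conj(T(ℂ²)) in ℂ × ℂ^{2×2} × ℂ^{2×2}, depending only on Q and Q′, with Ψ(0, Λ, Λ̃) ≠ 0 for all (Λ, Λ̃) ∈ T(ℂ²) × conj(T(ℂ²)), such that every local biholomorphism H = (F,G) : (ℂ²,0) → (ℂ²,0) satisfying the mapping identity for (Q,Q′) obeys F̄(χ,0) = χ · Ψ(χ, H′(0), conj(H′(0))) for all χ ∈ ℂ near 0, where F̄(χ,τ) := conj(F(conj χ, conj τ)). -/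

import Mathlib

open Filter Topology Matrix

noncomputable section

/-- Complex conjugation as a plain function. -/
def cj : ℂ → ℂ := (starRingEnd ℂ)

/-- Iterated partial derivative `∂_z^i ∂_w^j F (z, w)` of `F : ℂ → ℂ → ℂ`. -/
def pd (F : ℂ → ℂ → ℂ) (i j : ℕ) (z w : ℂ) : ℂ :=
  deriv^[i] (fun z' => deriv^[j] (F z') w) z

/-- `Q` is a normal-coordinates defining function (near `0`) of a germ of a
real-analytic hypersurface in `ℂ²`. -/
def IsNormalCoord (Q : ℂ → ℂ → ℂ → ℂ) : Prop :=
  AnalyticAt ℂ (fun p : ℂ × ℂ × ℂ => Q p.1 p.2.1 p.2.2) 0 ∧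
  (∀ᶠ p : ℂ × ℂ in 𝓝 0, Q p.1 0 p.2 = p.2) ∧
  (∀ᶠ p : ℂ × ℂ in 𝓝 0, Q 0 p.1 p.2 = p.2) ∧
  (∀ᶠ p : ℂ × ℂ × ℂ in 𝓝 0, Q p.1 p.2.1 (cj (Q (cj p.2.1) (cj p.1) (cj p.2.2))) = p.2.2)

/-- The mapping identity expressing that the germ at `0` of the holomorphic map
`H = (F, G)` (with `H(0) = 0`) sends the hypersurface defined by `Q` into the one
defined by `Q'`. -/
def SendsInto (Q Q' : ℂ → ℂ → ℂ → ℂ) (F G : ℂ → ℂ → ℂ) : Prop :=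
  AnalyticAt ℂ (fun p : ℂ × ℂ => F p.1 p.2) 0 ∧
  AnalyticAt ℂ (fun p : ℂ × ℂ => G p.1 p.2) 0 ∧
  F 0 0 = 0 ∧ G 0 0 = 0 ∧
  ∀ᶠ p : ℂ × ℂ × ℂ in 𝓝 0,
    G p.1 (Q p.1 p.2.1 p.2.2) =
      Q' (F p.1 (Q p.1 p.2.1 p.2.2)) (cj (F (cj p.2.1) (cj p.2.2))) (cj (G (cj p.2.1) (cj p.2.2)))

/-- Determinant of the Jacobian matrix of `H = (F, G)` at `0`. -/
def JacDet (F G : ℂ → ℂ → ℂ) : ℂ :=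
  pd F 1 0 0 0 * pd G 0 1 0 0 - pd F 0 1 0 0 * pd G 1 0 0 0

/-- The hypersurface defined by `Q` is not Levi-flat near `0`, i.e. `Q(z,χ,τ) ≢ τ`. -/
def NotLeviFlat (Q : ℂ → ℂ → ℂ → ℂ) : Prop :=
  ¬ ∀ᶠ p : ℂ × ℂ × ℂ in 𝓝 0, Q p.1 p.2.1 p.2.2 = p.2.2

/-- The hypersurface defined by `Q` is of finite type at `0`, i.e. `Q(z,χ,0) ≢ 0`. -/
def FiniteTypeAt (Q : ℂ → ℂ → ℂ → ℂ) : Prop :=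
  ¬ ∀ᶠ p : ℂ × ℂ in 𝓝 0, Q p.1 p.2 0 = 0

/-- `q_{αμ}(χ) = ∂_z^α ∂_τ^μ Q(0, χ, 0)`. -/
def qd (Q : ℂ → ℂ → ℂ → ℂ) (α μ : ℕ) (χ : ℂ) : ℂ :=
  deriv^[α] (fun z => deriv^[μ] (fun τ => Q z χ τ) 0) 0

/-- The hypersurface (germ) defined by `Q` as a subset of `ℂ²`. -/
def MSet (Q : ℂ → ℂ → ℂ → ℂ) : Set (ℂ × ℂ) := {p | p.2 = Q p.1 (cj p.1) (cj p.2)}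


/-- `T(ℂ²)`: invertible upper-triangular `2 × 2` complex matrices. -/
def Tmat : Set (Matrix (Fin 2) (Fin 2) ℂ) := {A | A 1 0 = 0 ∧ A 0 0 ≠ 0 ∧ A 1 1 ≠ 0}

/-- The image of `T(ℂ²)` under componentwise complex conjugation. -/
def TmatConj : Set (Matrix (Fin 2) (Fin 2) ℂ) := (fun A => A.map cj) '' Tmat

/-- The Jacobian matrix `H'(0)` of `H = (F, G)` at `0`. -/
def Jmat (F G : ℂ → ℂ → ℂ) : Matrix (Fin 2) (Fin 2) ℂ :=
  !![pd F 1 0 0 0, pd F 0 1 0 0; pd G 1 0 0 0, pd G 0 1 0 0]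

attribute [local instance] Matrix.normedAddCommGroup Matrix.normedSpace

section Division

variable {E : Type*} [NormedAddCommGroup E] [NormedSpace ℂ E]

/-- The contraction `(x, τ) ↦ (x, t τ)` of the last coordinate. -/
def scaleLast (E : Type*) [NormedAddCommGroup E] [NormedSpace ℂ E] (t : ℝ) :
    E × ℂ →L[ℂ] E × ℂ :=
  (ContinuousLinearMap.fst ℂ E ℂ).prod ((t : ℂ) • ContinuousLinearMap.snd ℂ E ℂ)

lemma scaleLast_apply (t : ℝ) (v : E × ℂ) : scaleLast E t v = (v.1, t * v.2) := by
  simp [scaleLast]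

lemma norm_scaleLast_apply_le {t : ℝ} (ht : |t| ≤ 1) (v : E × ℂ) :
    ‖scaleLast E t v‖ ≤ ‖v‖ := by
  rw [scaleLast_apply, Prod.norm_def, Prod.norm_def]
  refine max_le_max le_rfl ?_
  rw [norm_mul, Complex.norm_real, Real.norm_eq_abs]
  exact mul_le_of_le_one_left (norm_nonneg _) ht

lemma norm_scaleLast_le {t : ℝ} (ht : |t| ≤ 1) : ‖scaleLast E t‖ ≤ 1 :=
  ContinuousLinearMap.opNorm_le_bound _ zero_le_one fun v => by
    simpa using norm_scaleLast_apply_le ht v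

lemma continuous_scaleLast : Continuous (scaleLast E) := by
  have h : scaleLast E = fun t : ℝ =>
      (ContinuousLinearMap.inl ℂ E ℂ).comp (ContinuousLinearMap.fst ℂ E ℂ) +
        (t : ℂ) • (ContinuousLinearMap.inr ℂ E ℂ).comp (ContinuousLinearMap.snd ℂ E ℂ) := by
    funext t
    refine ContinuousLinearMap.ext fun v => ?_
    rw [scaleLast_apply]
    simp
  rw [h]
  exact continuous_const.add (Complex.continuous_ofReal.smul continuous_const)

lemma abs_le_one_of_mem_uIoc {t : ℝ} (ht : t ∈ Set.uIoc (0 : ℝ) 1) : |t| ≤ 1 := by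
  rw [Set.uIoc_of_le zero_le_one] at ht
  exact abs_le.2 ⟨by linarith [ht.1], ht.2⟩

/-- Averaging an analytic function over contractions of the last coordinate. -/
lemma AnalyticAt.integral_scaleLast {h : E × ℂ → ℂ} (hh : AnalyticAt ℂ h 0) :
    AnalyticAt ℂ (fun v : E × ℂ => ∫ t in (0 : ℝ)..1, h (scaleLast E t v)) 0 := by
  obtain ⟨p, r, hp⟩ := hh
  let P (n : ℕ) (t : ℝ) : ContinuousMultilinearMap ℂ (fun _ : Fin n => E × ℂ) ℂ :=
    (p n).compContinuousLinearMap fun _ => scaleLast E t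
  have hPc : ∀ n, Continuous (P n) := by
    intro n
    have h1 : Continuous fun t : ℝ =>
        ContinuousMultilinearMap.compContinuousLinearMapContinuousMultilinear ℂ
          (fun _ : Fin n => E × ℂ) (fun _ : Fin n => E × ℂ) ℂ (fun _ => scaleLast E t) :=
      (ContinuousMultilinearMap.cont _).comp (continuous_pi fun _ => continuous_scaleLast)
    exact h1.clm_apply continuous_const
  have hPn : ∀ n, ∀ t ∈ Set.uIoc (0 : ℝ) 1, ‖P n t‖ ≤ ‖p n‖ := by
    intro n t ht
    refine (ContinuousMultilinearMap.norm_compContinuousLinearMap_le _ _).trans ?_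
    refine mul_le_of_le_one_right (norm_nonneg _) ?_
    exact Finset.prod_le_one (fun _ _ => norm_nonneg _)
      fun _ _ => norm_scaleLast_le (abs_le_one_of_mem_uIoc ht)
  let q : FormalMultilinearSeries ℂ (E × ℂ) ℂ := fun n => ∫ t in (0 : ℝ)..1, P n t
  have hqn : ∀ n, ‖q n‖ ≤ ‖p n‖ := by
    intro n
    simpa using intervalIntegral.norm_integral_le_of_norm_le_const (hPn n)
  have hq : ∀ n v, q n (fun _ => v) = ∫ t in (0 : ℝ)..1, p n fun _ => scaleLast E t v := by
    intro n v
    have := (ContinuousMultilinearMap.apply ℂ (fun _ : Fin n => E × ℂ) ℂ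
      fun _ => v).intervalIntegral_comp_comm (μ := MeasureTheory.volume)
        ((hPc n).intervalIntegrable 0 1)
    exact this.symm
  refine ⟨q, r, hp.r_le.trans (FormalMultilinearSeries.radius_le_of_le hqn), hp.r_pos, ?_⟩
  intro y hy
  have hyr : ‖y‖ₑ < r := by simpa using hy
  have hmem : ∀ t ∈ Set.uIoc (0 : ℝ) 1, scaleLast E t y ∈ Metric.eball (0 : E × ℂ) r := by
    intro t ht
    have : ‖scaleLast E t y‖ₑ ≤ ‖y‖ₑ :=
      enorm_le_iff_norm_le.2 (norm_scaleLast_apply_le (abs_le_one_of_mem_uIoc ht) y)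
    simpa using this.trans_lt hyr
  simp only [zero_add, hq]
  refine intervalIntegral.hasSum_integral_of_dominated_convergence
    (fun n _ => ‖p n‖ * ‖y‖ ^ n) ?_ ?_ ?_ ?_ ?_
  · intro n
    refine Continuous.aestronglyMeasurable ?_
    exact (p n).cont.comp (continuous_pi fun _ => continuous_scaleLast.clm_apply continuous_const)
  · intro n
    refine .of_forall fun t ht => ?_
    refine ((p n).le_opNorm _).trans ?_
    simp only [Finset.prod_const, Finset.card_univ, Fintype.card_fin]
    gcongr
    exact norm_scaleLast_apply_le (abs_le_one_of_mem_uIoc ht) y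
  · refine .of_forall fun t ht => ?_
    have := p.summable_norm_mul_pow (r := ‖y‖₊) (lt_of_lt_of_le hyr hp.r_le)
    simpa using this
  · exact intervalIntegrable_const
  · refine .of_forall fun t ht => ?_
    simpa using hp.hasSum (hmem t ht)

/-- An analytic function vanishing on `{τ = 0}` is divisible by `τ`. -/
lemma AnalyticAt.exists_eq_last_mul {f : E × ℂ → ℂ} (hf : AnalyticAt ℂ f 0)
    (h0 : ∀ᶠ x in 𝓝 (0 : E), f (x, 0) = 0) :
    ∃ g : E × ℂ → ℂ, AnalyticAt ℂ g 0 ∧ ∀ᶠ v in 𝓝 (0 : E × ℂ), f v = v.2 * g v := by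
  have hd : AnalyticAt ℂ (fun v => fderiv ℂ f v (0, 1)) 0 :=
    ((ContinuousLinearMap.apply ℂ ℂ ((0, 1) : E × ℂ)).analyticAt _).comp hf.fderiv
  refine ⟨_, hd.integral_scaleLast, ?_⟩
  obtain ⟨ε, hε, hball⟩ := Metric.eventually_nhds_iff_ball.1
    (hf.eventually_analyticAt.and hd.eventually_analyticAt)
  filter_upwards [Metric.ball_mem_nhds (0 : E × ℂ) hε,
    (continuous_fst.tendsto (0 : E × ℂ)).eventually h0] with v hv hv0
  have hmem : ∀ t ∈ Set.uIcc (0 : ℝ) 1, scaleLast E t v ∈ Metric.ball (0 : E × ℂ) ε := by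
    intro t ht
    rw [Set.uIcc_of_le zero_le_one] at ht
    rw [mem_ball_zero_iff] at hv ⊢
    exact (norm_scaleLast_apply_le (abs_le.2 ⟨by linarith [ht.1], ht.2⟩) v).trans_lt hv
  have hderiv : ∀ t ∈ Set.uIcc (0 : ℝ) 1, HasDerivAt (fun t : ℝ => f (scaleLast E t v))
      (v.2 * fderiv ℂ f (scaleLast E t v) (0, 1)) t := by
    intro t ht
    have h1 : HasDerivAt (fun t : ℝ => scaleLast E t v) (0, v.2) t := by
      simp only [scaleLast_apply]
      refine (hasDerivAt_const t v.1).prodMk ?_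
      simpa using (Complex.ofRealCLM.hasDerivAt (x := t)).mul_const v.2
    have h2 := ((hball _ (hmem t ht)).1.differentiableAt.hasFDerivAt.restrictScalars
      ℝ).comp_hasDerivAt t h1
    have h3 : v.2 * fderiv ℂ f (scaleLast E t v) (0, 1) =
        fderiv ℂ f (scaleLast E t v) (0, v.2) := by
      have : ((0, v.2) : E × ℂ) = v.2 • ((0, 1) : E × ℂ) := by simp
      rw [this, map_smul, smul_eq_mul]
    rw [h3]
    exact h2
  have hcont : ContinuousOn (fun t : ℝ => v.2 * fderiv ℂ f (scaleLast E t v) (0, 1))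
      (Set.uIcc 0 1) := by
    refine continuousOn_const.mul fun t ht => ?_
    exact (ContinuousAt.comp (f := fun t : ℝ => scaleLast E t v)
      (hball _ (hmem t ht)).2.continuousAt
      (continuous_scaleLast.clm_apply continuous_const).continuousAt).continuousWithinAt
  have := intervalIntegral.integral_eq_sub_of_hasDerivAt hderiv hcont.intervalIntegrable
  rw [intervalIntegral.integral_const_mul] at this
  rw [this]
  simp [scaleLast_apply, hv0]

/-- A nonzero germ of an analytic function factors as `τ ^ m * g` with `g (x, 0) ≢ 0`. -/
lemma AnalyticAt.exists_eq_last_pow_mul {f : E × ℂ → ℂ} (hf : AnalyticAt ℂ f 0)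
    (h0 : ¬ ∀ᶠ v in 𝓝 (0 : E × ℂ), f v = 0) :
    ∃ (m : ℕ) (g : E × ℂ → ℂ), AnalyticAt ℂ g 0 ∧ (∀ᶠ v in 𝓝 (0 : E × ℂ), f v = v.2 ^ m * g v) ∧
      ¬ ∀ᶠ x in 𝓝 (0 : E), g (x, 0) = 0 := by
  by_contra! hcon
  have hall : ∀ m : ℕ, ∃ g : E × ℂ → ℂ, AnalyticAt ℂ g 0 ∧
      ∀ᶠ v in 𝓝 (0 : E × ℂ), f v = v.2 ^ m * g v := by
    intro m
    induction m with
    | zero => exact ⟨f, hf, by simp⟩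
    | succ m ih =>
      obtain ⟨g, hg, hfg⟩ := ih
      obtain ⟨k, hk, hgk⟩ := hg.exists_eq_last_mul (hcon m g hg hfg)
      refine ⟨k, hk, ?_⟩
      filter_upwards [hfg, hgk] with v h1 h2
      rw [h1, h2]; ring
  obtain ⟨ε, hε, hball⟩ := Metric.eventually_nhds_iff_ball.1 hf.eventually_analyticAt
  refine h0 ?_
  filter_upwards [Metric.ball_mem_nhds (0 : E × ℂ) hε] with v hv
  let ℓ : ℂ →L[ℂ] E × ℂ := (ContinuousLinearMap.id ℂ ℂ).smulRight v
  have hℓ : ∀ t, ℓ t = t • v := fun t => by simp [ℓ]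
  have hℓ0 : ℓ 0 = 0 := map_zero ℓ
  have hU : IsPreconnected (ℓ ⁻¹' Metric.ball 0 ε) := by
    refine Convex.isPreconnected ?_
    exact (convex_ball (0 : E × ℂ) ε).is_linear_preimage
      (ℓ.restrictScalars ℝ).toLinearMap.isLinear
  have han : AnalyticOnNhd ℂ (f ∘ ℓ) (ℓ ⁻¹' Metric.ball 0 ε) := fun t ht =>
    (hball _ ht).comp (ℓ.analyticAt t)
  have hz : (0 : ℂ) ∈ ℓ ⁻¹' Metric.ball 0 ε := by simp [hε]
  have hev : f ∘ ℓ =ᶠ[𝓝 0] 0 := by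
    refine analyticOrderAt_eq_top.1 ?_
    rw [ENat.eq_top_iff_forall_ge]
    intro m
    obtain ⟨g, hg, hfg⟩ := hall m
    refine (natCast_le_analyticOrderAt (han 0 hz)).2
      ⟨fun t => v.2 ^ m * g (ℓ t), analyticAt_const.mul
        (AnalyticAt.comp (by rwa [hℓ0]) (ℓ.analyticAt 0)), ?_⟩
    have : Tendsto ℓ (𝓝 0) (𝓝 0) := by simpa [hℓ0] using ℓ.continuous.tendsto 0
    filter_upwards [this.eventually hfg] with t ht
    simp only [Function.comp_apply, ht, sub_zero, smul_eq_mul]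
    simp only [hℓ, Prod.smul_snd, smul_eq_mul]
    ring
  have h1 : (1 : ℂ) ∈ ℓ ⁻¹' Metric.ball 0 ε := by
    simpa [hℓ] using hv
  simpa [hℓ] using han.eqOn_zero_of_preconnected_of_eventuallyEq_zero hU hz hev h1

end Division

section Segre

lemma ContinuousAt.eq_zero_of_eventually_punctured {h : ℂ → ℂ} (hc : ContinuousAt h 0)
    (h0 : ∀ᶠ z in 𝓝[≠] (0 : ℂ), h z = 0) : h 0 = 0 :=
  tendsto_nhds_unique (hc.tendsto.mono_left nhdsWithin_le_nhds)
    (tendsto_const_nhds.congr' (h0.mono fun _ hz => hz.symm))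

lemma eventually_punctured_last {E : Type*} [TopologicalSpace E] {P : E × ℂ → Prop} {e : E}
    (h : ∀ᶠ v in 𝓝 (e, (0 : ℂ)), P v) :
    ∀ᶠ x in 𝓝 e, ∀ᶠ τ in 𝓝[≠] (0 : ℂ), P (x, τ) :=
  h.curry_nhds.mono fun _ hx => hx.filter_mono nhdsWithin_le_nhds

/-- The leading terms of a normal defining function `Q`:
`Q(z,χ,τ) = τ + τ^m R(z,χ,τ)`, `R(z,χ,0) = z^α A(χ,z)` and `A(χ,0) = C (χ v(χ))^β`, where
`m` and `α` are the smallest possible exponents. The function `s` is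
`∂_z R(0,χ,0)` if `m = 0`, and vanishes otherwise. -/
structure SegreData (Q : ℂ → ℂ → ℂ → ℂ) where
  m : ℕ
  α : ℕ
  β : ℕ
  R : (ℂ × ℂ) × ℂ → ℂ
  A : ℂ × ℂ → ℂ
  s : ℂ → ℂ
  v : ℂ → ℂ
  C : ℂ
  β_ne : β ≠ 0
  analyticAt_R : AnalyticAt ℂ R 0
  eq_R : ∀ᶠ p : (ℂ × ℂ) × ℂ in 𝓝 0, Q p.1.2 p.1.1 p.2 = p.2 + p.2 ^ m * R p
  R_z_zero : ∀ᶠ χ in 𝓝 (0 : ℂ), R ((χ, 0), 0) = 0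
  R_χ_zero : ∀ᶠ z in 𝓝 (0 : ℂ), R ((0, z), 0) = 0
  analyticAt_A : AnalyticAt ℂ A 0
  eq_A : ∀ᶠ x : ℂ × ℂ in 𝓝 0, R (x, 0) = x.2 ^ α * A x
  C_ne : C ≠ 0
  analyticAt_v : AnalyticAt ℂ v 0
  v_zero : v 0 = 1
  eq_v : ∀ᶠ χ in 𝓝 (0 : ℂ), A (χ, 0) = C * (χ * v χ) ^ β
  analyticAt_s : AnalyticAt ℂ s 0
  s_zero : s 0 = 0
  s_of_m_ne : m ≠ 0 → ∀ χ, s χ = 0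
  hasDerivAt_s : m = 0 → ∀ᶠ χ in 𝓝 (0 : ℂ), HasDerivAt (fun z => R ((χ, z), 0)) (s χ) 0

lemma AnalyticAt.exists_eq_mul_pow {r : ℂ → ℂ} (hr : AnalyticAt ℂ r 0) (hr0 : r 0 = 0)
    (hne : ¬ ∀ᶠ χ in 𝓝 (0 : ℂ), r χ = 0) :
    ∃ (β : ℕ) (C : ℂ) (v : ℂ → ℂ), β ≠ 0 ∧ C ≠ 0 ∧ AnalyticAt ℂ v 0 ∧ v 0 = 1 ∧
      ∀ᶠ χ in 𝓝 (0 : ℂ), r χ = C * (χ * v χ) ^ β := by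
  obtain ⟨β, u, hu, hu0, hru⟩ := hr.exists_eventuallyEq_pow_smul_nonzero_iff.2 hne
  have hβ : β ≠ 0 := by
    rintro rfl
    have := hru.self_of_nhds
    simp [hr0] at this
    exact hu0 this.symm
  have hw : AnalyticAt ℂ (fun χ => u χ / u 0) 0 := hu.div analyticAt_const hu0
  have hw1 : u 0 / u 0 = 1 := div_self hu0
  have hv : AnalyticAt ℂ (fun χ => (u χ / u 0) ^ ((β : ℂ)⁻¹)) 0 := by
    refine hw.cpow analyticAt_const ?_
    simp only [hw1]
    exact Complex.one_mem_slitPlane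
  refine ⟨β, u 0, _, hβ, hu0, hv, by simp [hw1], ?_⟩
  filter_upwards [hru] with χ h
  rw [h, mul_pow, Complex.cpow_nat_inv_pow _ hβ, sub_zero, smul_eq_mul]
  field_simp

lemma IsNormalCoord.nonempty_segreData {Q : ℂ → ℂ → ℂ → ℂ} (hQ : IsNormalCoord Q)
    (hLF : NotLeviFlat Q) : Nonempty (SegreData Q) := by
  obtain ⟨han, hχ, hz, -⟩ := hQ
  have hσ : AnalyticAt ℂ (fun p : (ℂ × ℂ) × ℂ => (p.1.2, p.1.1, p.2)) 0 :=
    (analyticAt_snd.comp analyticAt_fst).prod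
      ((analyticAt_fst.comp analyticAt_fst).prod analyticAt_snd)
  have hf : AnalyticAt ℂ (fun p : (ℂ × ℂ) × ℂ => Q p.1.2 p.1.1 p.2 - p.2) 0 :=
    (AnalyticAt.comp (g := fun p : ℂ × ℂ × ℂ => Q p.1 p.2.1 p.2.2)
      (f := fun p : (ℂ × ℂ) × ℂ => (p.1.2, p.1.1, p.2)) han hσ).sub
      analyticAt_snd
  have hf0 : ¬ ∀ᶠ p in 𝓝 (0 : (ℂ × ℂ) × ℂ), Q p.1.2 p.1.1 p.2 - p.2 = 0 := by
    intro h
    refine hLF ?_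
    have ht : Tendsto (fun p : ℂ × ℂ × ℂ => ((p.2.1, p.1), p.2.2)) (𝓝 0) (𝓝 0) :=
      Continuous.tendsto (by fun_prop) 0
    exact (ht.eventually h).mono fun p hp => sub_eq_zero.1 hp
  obtain ⟨m, R, hR, hfR, hR0⟩ := hf.exists_eq_last_pow_mul hf0
  have hRc : ∀ᶠ x in 𝓝 (0 : ℂ × ℂ), ContinuousAt (fun τ => R (x, τ)) 0 :=
    (hR.eventually_analyticAt.curry_nhds).mono fun x hx =>
      (ContinuousAt.comp (f := fun τ => (x, τ)) hx.self_of_nhds.continuousAt (by fun_prop))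
  have hRf := eventually_punctured_last (e := (0 : ℂ × ℂ)) hfR
  have hvan : ∀ᶠ x in 𝓝 (0 : ℂ × ℂ), (∀ᶠ τ in 𝓝[≠] (0 : ℂ), Q x.2 x.1 τ = τ) →
      R (x, 0) = 0 := by
    filter_upwards [hRc, hRf] with x hc hx h
    refine hc.eq_zero_of_eventually_punctured ?_
    filter_upwards [hx, h, self_mem_nhdsWithin] with τ h1 h2 h3
    simp only [h2, sub_self] at h1
    exact (mul_eq_zero.1 h1.symm).resolve_left (pow_ne_zero _ h3)
  have hRz : ∀ᶠ χ in 𝓝 (0 : ℂ), R ((χ, 0), 0) = 0 := by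
    have ht : Tendsto (fun χ : ℂ => (χ, (0 : ℂ))) (𝓝 0) (𝓝 0) :=
      Continuous.tendsto (by fun_prop) 0
    filter_upwards [ht.eventually hvan, eventually_punctured_last (e := (0 : ℂ)) hz] with χ h1 h2
    exact h1 h2
  have hRχ : ∀ᶠ z in 𝓝 (0 : ℂ), R ((0, z), 0) = 0 := by
    have ht : Tendsto (fun z : ℂ => ((0 : ℂ), z)) (𝓝 0) (𝓝 0) :=
      Continuous.tendsto (by fun_prop) 0
    filter_upwards [ht.eventually hvan, eventually_punctured_last (e := (0 : ℂ)) hχ] with z h1 h2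
    exact h1 h2
  have hR0a : AnalyticAt ℂ (fun x : ℂ × ℂ => R (x, 0)) 0 :=
    AnalyticAt.comp (f := fun x : ℂ × ℂ => (x, (0 : ℂ))) hR (by fun_prop)
  obtain ⟨α, A, hA, hRA, hA0⟩ := hR0a.exists_eq_last_pow_mul hR0
  obtain ⟨S, hS, hRS⟩ := hR0a.exists_eq_last_mul hRz
  have hslice : ∀ {f : ℂ × ℂ → ℂ}, AnalyticAt ℂ f 0 → AnalyticAt ℂ (fun χ => f (χ, 0)) 0 :=
    fun hf => AnalyticAt.comp (f := fun χ : ℂ => (χ, (0 : ℂ))) hf (by fun_prop)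
  have hslice' : ∀ {f : ℂ × ℂ → ℂ}, AnalyticAt ℂ f 0 → ∀ k : ℕ,
      (∀ᶠ x in 𝓝 (0 : ℂ × ℂ), R (x, 0) = x.2 ^ k * f x) → f (0, 0) = 0 := by
    intro f hf k hk
    have hc : ContinuousAt (fun z => f (0, z)) 0 :=
      ContinuousAt.comp (f := fun z : ℂ => ((0 : ℂ), z)) hf.continuousAt (by fun_prop)
    refine hc.eq_zero_of_eventually_punctured ?_
    filter_upwards [(eventually_punctured_last (e := (0 : ℂ)) hk).self_of_nhds,
      hRχ.filter_mono nhdsWithin_le_nhds, self_mem_nhdsWithin] with z h1 h2 h3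
    rw [h2] at h1
    exact (mul_eq_zero.1 h1.symm).resolve_left (pow_ne_zero _ h3)
  obtain ⟨β, C, v, hβ, hC, hv, hv0, hrv⟩ :=
    (hslice hA).exists_eq_mul_pow (hslice' hA α hRA) hA0
  refine ⟨{
    m := m, α := α, β := β, R := R, A := A, v := v, C := C
    s := fun χ => if m = 0 then S (χ, 0) else 0
    β_ne := hβ
    analyticAt_R := hR
    eq_R := hfR.mono fun p hp => by rw [← hp]; ring
    R_z_zero := hRz
    R_χ_zero := hRχ
    analyticAt_A := hA
    eq_A := hRA
    C_ne := hC
    analyticAt_v := hv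
    v_zero := hv0
    eq_v := hrv
    analyticAt_s := ?_
    s_zero := ?_
    s_of_m_ne := fun h χ => if_neg h
    hasDerivAt_s := ?_ }⟩
  · split_ifs
    · exact hslice hS
    · exact analyticAt_const
  · simp only [ite_eq_right_iff]
    intro _
    exact hslice' hS 1 (by simpa using hRS)
  · intro hm
    have hSd : ∀ᶠ χ in 𝓝 (0 : ℂ), DifferentiableAt ℂ (fun z => S (χ, z)) 0 :=
      (hS.eventually_analyticAt.curry_nhds).mono fun χ hχ =>
        (AnalyticAt.comp (f := fun z => (χ, z)) hχ.self_of_nhds (by fun_prop)).differentiableAt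
    filter_upwards [hSd, hRS.curry_nhds] with χ h1 h2
    have h3 := (hasDerivAt_id (0 : ℂ)).mul h1.hasDerivAt
    simp only [id_eq, one_mul, zero_mul, add_zero] at h3
    rw [if_pos hm]
    exact h3.congr_of_eventuallyEq h2

end Segre

section Relation

lemma eq_of_pow_mul_eq {X Y : ℂ → ℂ} {x y : ℂ} {k l : ℕ}
    (hX : Tendsto X (𝓝[≠] 0) (𝓝 x)) (hY : Tendsto Y (𝓝[≠] 0) (𝓝 y)) (hx : x ≠ 0) (hy : y ≠ 0)
    (h : ∀ᶠ z in 𝓝[≠] (0 : ℂ), z ^ k * X z = z ^ l * Y z) : k = l ∧ x = y := by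
  have key : ∀ {X Y : ℂ → ℂ} {x y : ℂ} {k l : ℕ}, Tendsto X (𝓝[≠] 0) (𝓝 x) →
      Tendsto Y (𝓝[≠] 0) (𝓝 y) → (∀ᶠ z in 𝓝[≠] (0 : ℂ), z ^ k * X z = z ^ l * Y z) →
      k ≤ l → x = 0 ^ (l - k) * y := by
    intro X Y x y k l hX hY h hkl
    have hp : Tendsto (fun z : ℂ => z ^ (l - k)) (𝓝[≠] 0) (𝓝 (0 ^ (l - k))) :=
      ((continuous_pow (l - k)).tendsto 0).mono_left nhdsWithin_le_nhds
    refine tendsto_nhds_unique hX ((hp.mul hY).congr' ?_)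
    filter_upwards [h, self_mem_nhdsWithin] with z hz hz0
    refine mul_left_cancel₀ (pow_ne_zero k hz0) ?_
    rw [hz, ← mul_assoc, ← pow_add, Nat.add_sub_cancel' hkl]
  have hkl : k = l := by
    rcases lt_trichotomy k l with hlt | heq | hgt
    · refine absurd (key hX hY h hlt.le) ?_
      rw [zero_pow (by omega), zero_mul]
      exact hx
    · exact heq
    · refine absurd (key hY hX (h.mono fun _ hz => hz.symm) hgt.le) ?_
      rw [zero_pow (by omega), zero_mul]
      exact hy
  subst hkl
  exact ⟨rfl, by simpa using key hX hY h le_rfl⟩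

lemma eventually_continuousAt_right {f : ℂ × ℂ → ℂ} (hf : ∀ᶠ v in 𝓝 0, ContinuousAt f v) :
    ∀ᶠ χ in 𝓝 (0 : ℂ), ContinuousAt (fun z => f (χ, z)) 0 := by
  have ht : Tendsto (fun χ : ℂ => (χ, (0 : ℂ))) (𝓝 0) (𝓝 0) :=
    Continuous.tendsto (by fun_prop) 0
  filter_upwards [ht.eventually hf] with χ hχ
  exact ContinuousAt.comp (f := fun z => (χ, z)) hχ (by fun_prop)

namespace SegreData

variable {Q Q' : ℂ → ℂ → ℂ → ℂ}

lemma eventually_A_ne (D : SegreData Q) : ∀ᶠ χ in 𝓝[≠] (0 : ℂ), D.A (χ, 0) ≠ 0 := by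
  have hv : ∀ᶠ χ in 𝓝 (0 : ℂ), D.v χ ≠ 0 :=
    D.analyticAt_v.continuousAt.eventually_ne (by rw [D.v_zero]; exact one_ne_zero)
  filter_upwards [hv.filter_mono nhdsWithin_le_nhds, D.eq_v.filter_mono nhdsWithin_le_nhds,
    self_mem_nhdsWithin] with χ h1 h2 h3
  rw [h2]
  exact mul_ne_zero D.C_ne (pow_ne_zero _ (mul_ne_zero h3 h1))

lemma eventually_continuousAt_A (D : SegreData Q) :
    ∀ᶠ χ in 𝓝 (0 : ℂ), ContinuousAt (fun z => D.A (χ, z)) 0 :=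
  eventually_continuousAt_right
    (D.analyticAt_A.eventually_analyticAt.mono fun _ h => h.continuousAt)

lemma eventually_R_ne (D : SegreData Q) :
    ∀ᶠ χ in 𝓝[≠] (0 : ℂ), ∀ᶠ z in 𝓝[≠] (0 : ℂ), D.R ((χ, z), 0) ≠ 0 := by
  filter_upwards [D.eventually_A_ne, D.eventually_continuousAt_A.filter_mono nhdsWithin_le_nhds,
    (eventually_punctured_last (e := (0 : ℂ)) D.eq_A).filter_mono nhdsWithin_le_nhds]
    with χ h1 h2 h3
  filter_upwards [h3, (h2.eventually_ne h1).filter_mono nhdsWithin_le_nhds, self_mem_nhdsWithin]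
    with z h4 h5 h6
  rw [h4]
  exact mul_ne_zero (pow_ne_zero _ h6) h5

/-- Comparison of the lowest order terms in `z` on both sides of a mapping identity. -/
lemma coeff_eq (D : SegreData Q) (D' : SegreData Q') :
    ∀ᶠ p : ℂ × ℂ in (𝓝 0) ×ˢ (𝓝 0), D.A (p.1, 0) ≠ 0 → D'.A (p.2, 0) ≠ 0 →
      ∀ (E Φ : ℂ → ℂ) (K θ : ℂ), K ≠ 0 → θ ≠ 0 → Tendsto E (𝓝[≠] 0) (𝓝 K) →
      Tendsto (fun z => Φ z / z) (𝓝[≠] 0) (𝓝 θ) →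
      (∀ᶠ z in 𝓝[≠] (0 : ℂ), E z * D.R ((p.1, z), 0) = D'.R ((p.2, Φ z), 0)) →
      K * D.A (p.1, 0) = θ ^ D'.α * D'.A (p.2, 0) := by
  have h1 := (D.eventually_continuousAt_A).and (eventually_punctured_last (e := (0 : ℂ)) D.eq_A)
  have h2 := (D'.eventually_continuousAt_A).and (D'.eq_A.curry_nhds (x := (0 : ℂ)))
  filter_upwards [h1.prod_mk h2] with ⟨χ, y⟩ ⟨⟨hA, hRA⟩, ⟨hA', hRA'⟩⟩ hr hr' E Φ K θ hK hθ hE hΦ h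
  simp only at *
  have hΦ0 : Tendsto Φ (𝓝[≠] 0) (𝓝 0) := by
    have hz : Tendsto (fun z : ℂ => z) (𝓝[≠] 0) (𝓝 0) := tendsto_id.mono_left nhdsWithin_le_nhds
    have := hz.mul hΦ
    rw [zero_mul] at this
    refine this.congr' ?_
    filter_upwards [self_mem_nhdsWithin] with z hz
    exact mul_div_cancel₀ _ hz
  refine (eq_of_pow_mul_eq (k := D.α) (l := D'.α)
    (hE.mul (hA.tendsto.mono_left nhdsWithin_le_nhds))
    ((hΦ.pow D'.α).mul (hA'.tendsto.comp hΦ0)) (mul_ne_zero hK hr)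
    (mul_ne_zero (pow_ne_zero _ hθ) hr') ?_).2
  filter_upwards [h, hRA, hΦ0.eventually hRA', self_mem_nhdsWithin] with z h3 h4 h5 h6
  simp only [Function.comp_apply]
  rw [h4, h5] at h3
  rw [mul_left_comm, h3, ← mul_assoc, ← mul_pow, mul_div_cancel₀ _ h6]

/-- The mapping identity for `H = (F, w g)`, with `Fb`, `gb` in the role of the conjugate
functions, after inserting the expansion of `Q'`. -/
def Expanded (Q : ℂ → ℂ → ℂ → ℂ) (D' : SegreData Q') (F g Fb gb : ℂ × ℂ → ℂ)
    (p : (ℂ × ℂ) × ℂ) : Prop :=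
  Q p.1.2 p.1.1 p.2 * g (p.1.2, Q p.1.2 p.1.1 p.2) = p.2 * gb (p.1.1, p.2) +
    (p.2 * gb (p.1.1, p.2)) ^ D'.m *
      D'.R ((Fb (p.1.1, p.2), F (p.1.2, Q p.1.2 p.1.1 p.2)), p.2 * gb (p.1.1, p.2))

lemma tendsto_remainder (D' : SegreData Q') {F Fb gb : ℂ × ℂ → ℂ}
    (hF : ∀ᶠ v in 𝓝 0, ContinuousAt F v) (hFb : ∀ᶠ v in 𝓝 0, ContinuousAt Fb v)
    (hgb : ∀ᶠ v in 𝓝 0, ContinuousAt gb v) (hF0 : F 0 = 0) (hFb0 : Fb 0 = 0) :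
    ∀ᶠ x : ℂ × ℂ in 𝓝 0, ∀ q : ℂ → ℂ, Tendsto q (𝓝[≠] 0) (𝓝 0) →
      Tendsto (fun τ => gb (x.1, τ) ^ D'.m *
        D'.R ((Fb (x.1, τ), F (x.2, q τ)), τ * gb (x.1, τ))) (𝓝[≠] 0)
        (𝓝 (gb (x.1, 0) ^ D'.m * D'.R ((Fb (x.1, 0), F (x.2, 0)), 0))) := by
  have hpt : Tendsto (fun x : ℂ × ℂ => ((Fb (x.1, 0), F (x.2, 0)), (0 : ℂ))) (𝓝 0) (𝓝 0) := by
    have h1 : ContinuousAt (fun x : ℂ × ℂ => Fb (x.1, 0)) 0 :=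
      ContinuousAt.comp (f := fun x : ℂ × ℂ => (x.1, (0 : ℂ))) hFb.self_of_nhds (by fun_prop)
    have h2 : ContinuousAt (fun x : ℂ × ℂ => F (x.2, 0)) 0 :=
      ContinuousAt.comp (f := fun x : ℂ × ℂ => (x.2, (0 : ℂ))) hF.self_of_nhds (by fun_prop)
    have h3 : ContinuousAt (fun x : ℂ × ℂ => ((Fb (x.1, 0), F (x.2, 0)), (0 : ℂ))) 0 :=
      (h1.prodMk h2).prodMk continuousAt_const
    have h4 := h3.tendsto
    have h5 : ((Fb ((0 : ℂ × ℂ).1, 0), F ((0 : ℂ × ℂ).2, 0)), (0 : ℂ)) = 0 := by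
      change ((Fb 0, F 0), (0 : ℂ)) = 0
      rw [hF0, hFb0]; rfl
    rwa [h5] at h4
  have hfst : Tendsto (Prod.fst : ℂ × ℂ → ℂ) (𝓝 0) (𝓝 0) := continuous_fst.tendsto 0
  have hsnd : Tendsto (fun x : ℂ × ℂ => (x.2, (0 : ℂ))) (𝓝 0) (𝓝 0) :=
    Continuous.tendsto (by fun_prop) 0
  filter_upwards [hpt.eventually D'.analyticAt_R.eventually_analyticAt,
    hfst.eventually (eventually_continuousAt_right hFb),
    hfst.eventually (eventually_continuousAt_right hgb), hsnd.eventually hF]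
    with x hR hFbx hgbx hFx q hq
  have l1 : Tendsto (fun τ => gb (x.1, τ)) (𝓝[≠] 0) (𝓝 (gb (x.1, 0))) :=
    hgbx.tendsto.mono_left nhdsWithin_le_nhds
  have l2 : Tendsto (fun τ => Fb (x.1, τ)) (𝓝[≠] 0) (𝓝 (Fb (x.1, 0))) :=
    hFbx.tendsto.mono_left nhdsWithin_le_nhds
  have l3 : Tendsto (fun τ => F (x.2, q τ)) (𝓝[≠] 0) (𝓝 (F (x.2, 0))) :=
    hFx.tendsto.comp (tendsto_const_nhds.prodMk_nhds hq)
  have l4 : Tendsto (fun τ => τ * gb (x.1, τ)) (𝓝[≠] 0) (𝓝 0) := by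
    simpa using (tendsto_id.mono_left nhdsWithin_le_nhds :
      Tendsto (fun τ : ℂ => τ) (𝓝[≠] 0) (𝓝 0)).mul l1
  exact (l1.pow _).mul (hR.continuousAt.tendsto.comp ((l2.prodMk_nhds l3).prodMk_nhds l4))

lemma tendsto_sub_div_pow {h q R : ℂ → ℂ} {d r : ℂ} {m : ℕ} (hh : HasStrictDerivAt h d 0)
    (hq : Tendsto q (𝓝[≠] 0) (𝓝 0)) (hR : Tendsto R (𝓝[≠] 0) (𝓝 r))
    (hqR : ∀ᶠ τ in 𝓝[≠] (0 : ℂ), q τ = τ + τ ^ m * R τ) :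
    Tendsto (fun τ => (h (q τ) - h τ) / τ ^ m) (𝓝[≠] 0) (𝓝 (d * r)) := by
  have hid : Tendsto (fun τ : ℂ => τ) (𝓝[≠] 0) (𝓝 0) := tendsto_id.mono_left nhdsWithin_le_nhds
  have h1 : (fun τ => h (q τ) - h τ - (q τ - τ) * d) =o[𝓝[≠] 0] fun τ => q τ - τ := by
    have h0 := hh.hasStrictFDerivAt.isLittleO.comp_tendsto (hq.prodMk_nhds hid)
    simpa [Function.comp_def] using h0
  have h2 : (fun τ => q τ - τ) =O[𝓝[≠] 0] fun τ => τ ^ m := by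
    have h3 : (fun τ => τ ^ m * R τ) =O[𝓝[≠] 0] fun τ => τ ^ m := by
      simpa using (Asymptotics.isBigO_refl (fun τ : ℂ => τ ^ m) (𝓝[≠] 0)).mul (hR.isBigO_one ℂ)
    exact h3.congr' (hqR.mono fun τ hτ => by simp [hτ]) .rfl
  have h4 := (h1.trans_isBigO h2).tendsto_div_nhds_zero.add (hR.const_mul d)
  rw [zero_add] at h4
  refine h4.congr' ?_
  filter_upwards [hqR, self_mem_nhdsWithin] with τ h5 h6
  have h7 : τ ^ m ≠ 0 := pow_ne_zero m h6
  rw [div_add' _ _ _ h7, h5]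
  congr 1
  ring

/-- The lowest order terms in `τ` of the mapping identity, if both hypersurfaces are of
infinite type. -/
lemma coeff_τ_eq (hQ : IsNormalCoord Q) (D : SegreData Q) (D' : SegreData Q')
    {F g Fb gb : ℂ × ℂ → ℂ} (hm : D.m ≠ 0) (hm' : D'.m ≠ 0)
    (hF : ∀ᶠ v in 𝓝 0, ContinuousAt F v) (hg : AnalyticAt ℂ g 0)
    (hFb : ∀ᶠ v in 𝓝 0, ContinuousAt Fb v) (hgb : ∀ᶠ v in 𝓝 0, ContinuousAt gb v)
    (hF0 : F 0 = 0) (hFb0 : Fb 0 = 0) (hg0 : g 0 ≠ 0)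
    (hI : ∀ᶠ p in 𝓝 0, Expanded Q D' F g Fb gb p) :
    ∀ᶠ x : ℂ × ℂ in 𝓝 0, D.R (x, 0) ≠ 0 → D'.R ((Fb (x.1, 0), F (x.2, 0)), 0) ≠ 0 →
      g (x.2, 0) * D.R (x, 0) = g 0 ^ D'.m * D'.R ((Fb (x.1, 0), F (x.2, 0)), 0) ∧
        D.m = D'.m := by
  have hIx := eventually_punctured_last (e := (0 : ℂ × ℂ)) hI
  have hrem := D'.tendsto_remainder hF hFb hgb hF0 hFb0
  have hleft : Tendsto (fun x : ℂ × ℂ => (x.1, (0 : ℂ))) (𝓝 0) (𝓝 0) :=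
    Continuous.tendsto (by fun_prop) 0
  have hright : Tendsto (fun x : ℂ × ℂ => ((0 : ℂ), x.2)) (𝓝 0) (𝓝 0) :=
    Continuous.tendsto (by fun_prop) 0
  have hright' : Tendsto (fun x : ℂ × ℂ => (x.2, (0 : ℂ))) (𝓝 0) (𝓝 0) :=
    Continuous.tendsto (by fun_prop) 0
  have hfst : Tendsto (Prod.fst : ℂ × ℂ → ℂ) (𝓝 0) (𝓝 0) := continuous_fst.tendsto 0
  have hsnd : Tendsto (Prod.snd : ℂ × ℂ → ℂ) (𝓝 0) (𝓝 0) := continuous_snd.tendsto 0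
  have hQχ := eventually_punctured_last (e := (0 : ℂ)) hQ.2.1
  have hQz := eventually_punctured_last (e := (0 : ℂ)) hQ.2.2.1
  have hFbχ : Tendsto (fun x : ℂ × ℂ => Fb (x.1, 0)) (𝓝 0) (𝓝 0) := by
    have := hFb.self_of_nhds.tendsto
    rw [hFb0] at this
    exact this.comp hleft
  have hFz : Tendsto (fun x : ℂ × ℂ => F (x.2, 0)) (𝓝 0) (𝓝 0) := by
    have := hF.self_of_nhds.tendsto
    rw [hF0] at this
    exact this.comp hright'
  have hgstrict : ∀ᶠ x : ℂ × ℂ in 𝓝 0,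
      HasStrictDerivAt (fun w => w * g (x.2, w)) (g (x.2, 0)) 0 := by
    filter_upwards [hright'.eventually hg.eventually_analyticAt] with x hx
    have h1 : AnalyticAt ℂ (fun w => g (x.2, w)) 0 :=
      AnalyticAt.comp (f := fun w => (x.2, w)) hx (by fun_prop)
    simpa using (hasStrictDerivAt_id (0 : ℂ)).fun_mul h1.hasStrictDerivAt
  have hgc : ContinuousAt (fun w => g (0, w)) 0 :=
    ContinuousAt.comp (f := fun w => ((0 : ℂ), w)) hg.continuousAt (by fun_prop)
  have hRc : ∀ᶠ x in 𝓝 (0 : ℂ × ℂ), ContinuousAt (fun τ => D.R (x, τ)) 0 :=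
    (D.analyticAt_R.eventually_analyticAt.curry_nhds).mono fun x hx =>
      (ContinuousAt.comp (f := fun τ => (x, τ)) hx.self_of_nhds.continuousAt (by fun_prop))
  have hid : Tendsto (fun τ : ℂ => τ) (𝓝[≠] 0) (𝓝 0) := tendsto_id.mono_left nhdsWithin_le_nhds
  filter_upwards [hIx, hleft.eventually hIx, hright.eventually hIx, hrem, hleft.eventually hrem,
    hright.eventually hrem, hfst.eventually hQz, hsnd.eventually hQχ,
    hFbχ.eventually D'.R_z_zero, hFz.eventually D'.R_χ_zero, hgstrict, hRc,
    eventually_punctured_last (e := (0 : ℂ × ℂ)) D.eq_R,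
    hfst.eventually (eventually_continuousAt_right hgb),
    hright'.eventually (hg.continuousAt.eventually_ne hg0)]
    with ⟨χ, z⟩ i1 i2 i3 t1 t2 t3 qz qχ r1 r2 hst hc hqR hgbχ hgz hne hne'
  simp only at *
  have i4 := hIx.self_of_nhds
  have t4 := hrem.self_of_nhds
  have q0 := hQz.self_of_nhds
  have hF0' : F (0, 0) = 0 := hF0
  have hFb0' : Fb (0, 0) = 0 := hFb0
  have hR0 := hc.tendsto.mono_left (nhdsWithin_le_nhds (s := {0}ᶜ))
  have hq : Tendsto (fun τ => Q z χ τ) (𝓝[≠] 0) (𝓝 0) := by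
    have h1 := hid.add ((hid.pow D.m).mul hR0)
    rw [zero_pow hm, zero_mul, add_zero] at h1
    exact h1.congr' (hqR.mono fun τ hτ => hτ.symm)
  have s1 := t1 _ hq
  have s2 := t2 _ hid
  have s3 := t3 _ hid
  have s4 := t4 _ hid
  simp only [Prod.fst_zero, Prod.snd_zero, hF0', hFb0'] at s2 s3 s4 r2
  rw [r1, mul_zero] at s2
  rw [r2, mul_zero] at s3
  rw [D'.R_z_zero.self_of_nhds, mul_zero] at s4
  have hgbeq : gb (χ, 0) = g 0 := by
    refine tendsto_nhds_unique (f := fun τ => g (0, τ)) (l := 𝓝[≠] 0) ?_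
      (hgc.tendsto.mono_left nhdsWithin_le_nhds)
    have h1 := (hgbχ.tendsto.mono_left (nhdsWithin_le_nhds (s := {0}ᶜ))).add
      ((hid.pow (D'.m - 1)).mul s2)
    rw [mul_zero, add_zero] at h1
    refine h1.congr' ?_
    filter_upwards [i2, qz, self_mem_nhdsWithin] with τ h2 h3 h4
    simp only [Expanded, h3] at h2
    refine mul_left_cancel₀ h4 ?_
    obtain ⟨k, hk⟩ := Nat.exists_eq_succ_of_ne_zero hm'
    rw [h2, mul_pow, hk]
    simp only [Nat.succ_eq_add_one, Nat.add_sub_cancel, pow_succ]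
    ring
  have hX := tendsto_sub_div_pow hst hq hR0 hqR
  have hY := ((s1.sub s3).sub s2).add s4
  simp only [sub_zero, add_zero] at hY
  rw [hgbeq] at hY
  refine (eq_of_pow_mul_eq hX hY (mul_ne_zero hgz hne)
    (mul_ne_zero (pow_ne_zero _ hg0) hne') ?_).symm
  filter_upwards [i1, i2, i3, i4, qz, qχ, q0, self_mem_nhdsWithin] with τ j1 j2 j3 j4 e1 e2 e3 hτ
  simp only [Expanded, e1, e2, e3, Prod.fst_zero, Prod.snd_zero] at j1 j2 j3 j4
  rw [mul_div_cancel₀ _ (pow_ne_zero _ hτ), j1]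
  simp only [mul_pow] at *
  linear_combination -j2 - j3 + j4

lemma tendsto_R_right (D : SegreData Q) :
    ∀ᶠ χ in 𝓝 (0 : ℂ), Tendsto (fun z => D.R ((χ, z), 0)) (𝓝 0) (𝓝 0) := by
  have hR : ∀ᶠ v in 𝓝 (0 : ℂ × ℂ), ContinuousAt (fun x : ℂ × ℂ => D.R (x, 0)) v := by
    have ht : Tendsto (fun v : ℂ × ℂ => (v, (0 : ℂ))) (𝓝 0) (𝓝 0) :=
      Continuous.tendsto (by fun_prop) 0
    filter_upwards [ht.eventually D.analyticAt_R.eventually_analyticAt] with v hv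
    exact ContinuousAt.comp (f := fun x : ℂ × ℂ => (x, (0 : ℂ))) hv.continuousAt (by fun_prop)
  filter_upwards [eventually_continuousAt_right hR, D.R_z_zero] with χ h1 h2
  have h3 := h1.tendsto
  rwa [h2] at h3

lemma eventually_Q_zero (D : SegreData Q) :
    ∀ᶠ χ in 𝓝 (0 : ℂ), ∀ᶠ z in 𝓝 (0 : ℂ), Q z χ 0 = 0 ^ D.m * D.R ((χ, z), 0) := by
  have h := D.eq_R.curry_nhds (x := (0 : ℂ × ℂ)).mono fun x hx => hx.self_of_nhds
  exact (h.curry_nhds (x := (0 : ℂ))).mono fun χ hχ => hχ.mono fun z hz => by simpa using hz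

/-- The relation between the leading coefficients of `Q` and `Q'` along the Segre variety
through the origin. -/
lemma segre_relation (hQ : IsNormalCoord Q) (D : SegreData Q) (D' : SegreData Q')
    {F g Fb gb : ℂ × ℂ → ℂ} {L : ℂ × ℂ →L[ℂ] ℂ} (hF : AnalyticAt ℂ F 0) (hg : AnalyticAt ℂ g 0)
    (hFb : ∀ᶠ v in 𝓝 0, ContinuousAt Fb v) (hgb : ∀ᶠ v in 𝓝 0, ContinuousAt gb v)
    (hF0 : F 0 = 0) (hFb0 : Fb 0 = 0) (hg0 : g 0 ≠ 0) (hL : HasFDerivAt F L 0)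
    (hL0 : L (1, 0) ≠ 0) (hFbχ : Tendsto (fun χ => Fb (χ, 0)) (𝓝[≠] 0) (𝓝[≠] 0))
    (hI : ∀ᶠ p in 𝓝 0, Expanded Q D' F g Fb gb p) :
    ∃ K : ℂ, K ≠ 0 ∧ ∀ᶠ χ in 𝓝[≠] (0 : ℂ),
      K * D.A (χ, 0) = (L (1, 0) + L (0, 1) * D.s χ) ^ D'.α * D'.A (Fb (χ, 0), 0) := by
  have hle : 𝓝[≠] (0 : ℂ) ≤ 𝓝 0 := nhdsWithin_le_nhds
  have hid : Tendsto (fun τ : ℂ => τ) (𝓝[≠] 0) (𝓝 0) := hle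
  have hpair : Tendsto (fun χ => (χ, Fb (χ, 0))) (𝓝[≠] 0) ((𝓝 0) ×ˢ (𝓝 0)) :=
    hid.prodMk (hFbχ.mono_right hle)
  have hcoeff := hpair.eventually (D.coeff_eq D')
  have hA := D.eventually_A_ne
  have hA' := hFbχ.eventually D'.eventually_A_ne
  have hR := D.eventually_R_ne
  have hR' := hFbχ.eventually D'.eventually_R_ne
  have hFc : ∀ᶠ v in 𝓝 0, ContinuousAt F v :=
    hF.eventually_analyticAt.mono fun _ h => h.continuousAt
  have hL' : ∀ t : ℂ, L (1, t) = L (1, 0) + L (0, 1) * t := by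
    intro t
    have h1 : ((1 : ℂ), t) = (1, 0) + t • (0, 1) := by simp
    rw [h1, map_add, map_smul, smul_eq_mul, mul_comm]
  have hFcurve : ∀ (r : ℂ → ℂ) (t : ℂ), r 0 = 0 → HasDerivAt r t 0 →
      HasDerivAt (fun z => F (z, r z)) (L (1, 0) + L (0, 1) * t) 0 := by
    intro r t hr0 hr
    rw [← hL']
    have h1 : HasDerivAt (fun z => (z, r z)) (1, t) 0 := (hasDerivAt_id (0 : ℂ)).prodMk hr
    refine HasFDerivAt.comp_hasDerivAt (f := fun z => (z, r z)) 0 ?_ h1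
    simp only [hr0]
    exact hL
  have hslope : ∀ {Φ : ℂ → ℂ} {θ : ℂ}, Φ 0 = 0 → HasDerivAt Φ θ 0 →
      Tendsto (fun z => Φ z / z) (𝓝[≠] 0) (𝓝 θ) := by
    intro Φ θ h0 h
    refine h.tendsto_slope_zero.congr fun z => ?_
    simp [h0, div_eq_inv_mul]
  have hF0d : HasDerivAt (fun z => F (z, 0)) (L (1, 0)) 0 := by
    simpa using hFcurve (fun _ => 0) 0 rfl (hasDerivAt_const _ _)
  have hF0p : Tendsto (fun z => F (z, 0)) (𝓝[≠] 0) (𝓝[≠] 0) := by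
    have h := hF0d.tendsto_nhdsNE hL0
    rwa [show F (0, 0) = 0 from hF0] at h
  have hIz : ∀ᶠ χ in 𝓝[≠] (0 : ℂ), ∀ᶠ z in 𝓝 (0 : ℂ), Expanded Q D' F g Fb gb ((χ, z), 0) := by
    have h := hI.curry_nhds (x := (0 : ℂ × ℂ)).mono fun x hx => hx.self_of_nhds
    exact (h.curry_nhds (x := (0 : ℂ))).filter_mono hle
  have hQ0 := D.eventually_Q_zero.filter_mono hle
  have hRt := D.tendsto_R_right.filter_mono hle
  have hgt : ∀ {r : ℂ → ℂ}, Tendsto r (𝓝 0) (𝓝 0) →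
      Tendsto (fun z => g (z, r z)) (𝓝[≠] 0) (𝓝 (g 0)) := fun hr =>
    hg.continuousAt.tendsto.comp ((hid.prodMk_nhds (hr.mono_left hle)))
  by_cases hm : D.m = 0 <;> by_cases hm' : D'.m = 0
  · refine ⟨g 0, hg0, ?_⟩
    have hθ : ∀ᶠ χ in 𝓝[≠] (0 : ℂ), L (1, 0) + L (0, 1) * D.s χ ≠ 0 := by
      have h : ContinuousAt (fun χ => L (1, 0) + L (0, 1) * D.s χ) 0 :=
        continuousAt_const.add (continuousAt_const.mul D.analyticAt_s.continuousAt)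
      exact (h.eventually_ne (by simpa [D.s_zero] using hL0)).filter_mono hle
    filter_upwards [hcoeff, hA, hA', hIz, hQ0, hRt, hθ, (D.hasDerivAt_s hm).filter_mono hle,
      D.R_z_zero.filter_mono hle] with χ h1 h2 h3 h4 h5 h6 h7 h8 h9
    refine h1 h2 h3 (fun z => g (z, D.R ((χ, z), 0))) (fun z => F (z, D.R ((χ, z), 0))) _ _
      hg0 h7 (hgt h6) (hslope ?_ (hFcurve _ _ h9 h8)) ?_
    · rw [h9]
      exact hF0
    · filter_upwards [h4.filter_mono hle, h5.filter_mono hle] with z e1 e2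
      simp only [Expanded, e2, hm, hm', pow_zero, one_mul, zero_mul, zero_add] at e1
      rw [mul_comm]
      exact e1
  · exfalso
    obtain ⟨χ, h1, h2, h3, h4⟩ := (hIz.and (hQ0.and (hRt.and hR))).exists
    obtain ⟨z, e1, e2, e3, e4⟩ := ((h1.filter_mono hle).and ((h2.filter_mono hle).and
      (((hgt h3).eventually_ne hg0).and h4))).exists
    simp only [Expanded, e2, hm, pow_zero, one_mul, zero_mul, zero_add, zero_pow hm'] at e1
    exact mul_ne_zero e4 e3 e1
  · exfalso
    obtain ⟨χ, h1, h2, h3⟩ := (hIz.and (hQ0.and hR')).exists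
    obtain ⟨z, e1, e2, e3⟩ := ((h1.filter_mono hle).and ((h2.filter_mono hle).and
      (hF0p.eventually h3))).exists
    simp only [Expanded, e2, hm', pow_zero, one_mul, zero_mul, zero_add, zero_pow hm] at e1
    exact e3 e1.symm
  · have hp : g 0 ^ D'.m ≠ 0 := pow_ne_zero _ hg0
    have hK : g 0 / g 0 ^ D'.m ≠ 0 := div_ne_zero hg0 hp
    refine ⟨_, hK, ?_⟩
    have hτ := ((coeff_τ_eq hQ D D' hm hm' hFc hg hFb hgb hF0 hFb0 hg0 hI).curry_nhds
      (x := (0 : ℂ))).filter_mono hle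
    filter_upwards [hcoeff, hA, hA', hR, hR', hτ] with χ h1 h2 h3 h4 h5 h6
    rw [D.s_of_m_ne hm, mul_zero, add_zero]
    refine h1 h2 h3 (fun z => g (z, 0) / g 0 ^ D'.m) (fun z => F (z, 0)) _ _ hK hL0
      ((hgt tendsto_const_nhds).div_const _) (hslope hF0 hF0d) ?_
    filter_upwards [h6.filter_mono hle, h4, hF0p.eventually h5] with z e1 e2 e3
    rw [div_mul_eq_mul_div, (e1 e2 e3).1, mul_div_cancel_left₀ _ hp]

end SegreData

end Relation

section Jacobian

lemma continuous_cj : Continuous cj := Complex.continuous_conj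

lemma cj_zero : cj 0 = 0 := map_zero _

lemma cj_mul (x y : ℂ) : cj (x * y) = cj x * cj y := map_mul _ x y

lemma cj_cj (x : ℂ) : cj (cj x) = x := Complex.conj_conj x

lemma cj_ne_zero {x : ℂ} (hx : x ≠ 0) : cj x ≠ 0 := fun h => hx (by rw [← cj_cj x, h, cj_zero])

lemma HasDerivAt.cj_cj {f : ℂ → ℂ} {d : ℂ} (hf : HasDerivAt f d 0) :
    HasDerivAt (fun x => cj (f (cj x))) (cj d) 0 := by
  have h : HasDerivAt f d (cj 0) := by rwa [cj_zero]
  have h2 := HasDerivAt.conj_conj h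
  simpa [cj, Function.comp_def] using h2

lemma eventually_continuousAt_cj_cj {f : ℂ × ℂ → ℂ} (hf : AnalyticAt ℂ f 0) :
    ∀ᶠ v in 𝓝 (0 : ℂ × ℂ), ContinuousAt (fun v : ℂ × ℂ => cj (f (cj v.1, cj v.2))) v := by
  have hc : Continuous fun v : ℂ × ℂ => (cj v.1, cj v.2) :=
    (continuous_cj.comp continuous_fst).prodMk (continuous_cj.comp continuous_snd)
  have ht : Tendsto (fun v : ℂ × ℂ => (cj v.1, cj v.2)) (𝓝 0) (𝓝 0) :=
    hc.tendsto' _ _ (by simp [cj_zero])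
  filter_upwards [ht.eventually hf.eventually_analyticAt] with v hv
  exact continuous_cj.continuousAt.comp
    (ContinuousAt.comp (f := fun v : ℂ × ℂ => (cj v.1, cj v.2)) hv.continuousAt hc.continuousAt)

lemma pd_one_zero (F : ℂ → ℂ → ℂ) : pd F 1 0 0 0 = deriv (fun z => F z 0) 0 := rfl

lemma pd_zero_one (F : ℂ → ℂ → ℂ) : pd F 0 1 0 0 = deriv (F 0) 0 := rfl

variable {Q Q' : ℂ → ℂ → ℂ → ℂ} {F G : ℂ → ℂ → ℂ}

lemma SendsInto.eventually_G_zero (hQ : IsNormalCoord Q) (hQ' : IsNormalCoord Q')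
    (h : SendsInto Q Q' F G) : ∀ᶠ z in 𝓝 (0 : ℂ), G z 0 = 0 := by
  obtain ⟨hF, -, hF0, hG0, hI⟩ := h
  have ht : Tendsto (fun z : ℂ => (z, (0 : ℂ), (0 : ℂ))) (𝓝 0) (𝓝 0) :=
    Continuous.tendsto (by fun_prop) 0
  have ht2 : Tendsto (fun z : ℂ => (z, (0 : ℂ))) (𝓝 0) (𝓝 0) :=
    Continuous.tendsto (by fun_prop) 0
  have hFt : Tendsto (fun z : ℂ => (F z 0, (0 : ℂ))) (𝓝 0) (𝓝 0) := by
    have h1 : ContinuousAt (fun z : ℂ => (F z 0, (0 : ℂ))) 0 :=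
      (ContinuousAt.comp (f := fun z : ℂ => (z, (0 : ℂ))) (g := fun p : ℂ × ℂ => F p.1 p.2)
        hF.continuousAt (by fun_prop)).prodMk continuousAt_const
    have h2 := h1.tendsto
    simp only [hF0] at h2
    exact h2
  filter_upwards [ht.eventually hI, ht2.eventually hQ.2.1, hFt.eventually hQ'.2.1] with z h1 h2 h3
  simp only [cj_zero, hF0, hG0] at h1 h2 h3
  rw [h2, h3] at h1
  exact h1

lemma SendsInto.expanded (hQ : IsNormalCoord Q) (D' : SegreData Q') (h : SendsInto Q Q' F G)
    {g : ℂ × ℂ → ℂ} (hGg : ∀ᶠ v in 𝓝 (0 : ℂ × ℂ), G v.1 v.2 = v.2 * g v) :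
    ∀ᶠ p in 𝓝 0, SegreData.Expanded Q D' (fun v => F v.1 v.2) g
      (fun v => cj (F (cj v.1) (cj v.2))) (fun v => cj (g (cj v.1, cj v.2))) p := by
  obtain ⟨hF, hG, hF0, hG0, hI⟩ := h
  have hσ : Tendsto (fun p : (ℂ × ℂ) × ℂ => (p.1.2, p.1.1, p.2)) (𝓝 0) (𝓝 0) :=
    Continuous.tendsto (by fun_prop) 0
  have hQ0 : Q 0 0 0 = 0 := hQ.2.1.self_of_nhds
  have hQt : Tendsto (fun p : (ℂ × ℂ) × ℂ => Q p.1.2 p.1.1 p.2) (𝓝 0) (𝓝 0) := by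
    have h1 := hQ.1.continuousAt.tendsto
    simp only [Prod.fst_zero, Prod.snd_zero, hQ0] at h1
    exact h1.comp hσ
  have hzQ : Tendsto (fun p : (ℂ × ℂ) × ℂ => (p.1.2, Q p.1.2 p.1.1 p.2)) (𝓝 0) (𝓝 0) :=
    Tendsto.prodMk_nhds (Continuous.tendsto' (by fun_prop) _ _ rfl) hQt
  have hcc : Tendsto (fun p : (ℂ × ℂ) × ℂ => (cj p.1.1, cj p.2)) (𝓝 0) (𝓝 0) := by
    refine Continuous.tendsto' ?_ _ _ (by simp [cj_zero])
    exact (continuous_cj.comp (by fun_prop)).prodMk (continuous_cj.comp (by fun_prop))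
  have htF : Tendsto (fun v : ℂ × ℂ => F v.1 v.2) (𝓝 0) (𝓝 0) := by
    simpa only [Prod.fst_zero, Prod.snd_zero, hF0] using hF.continuousAt.tendsto
  have htG : Tendsto (fun v : ℂ × ℂ => G v.1 v.2) (𝓝 0) (𝓝 0) := by
    simpa only [Prod.fst_zero, Prod.snd_zero, hG0] using hG.continuousAt.tendsto
  have htc : Tendsto cj (𝓝 0) (𝓝 0) := continuous_cj.tendsto' _ _ cj_zero
  have hfull : Tendsto (fun p : (ℂ × ℂ) × ℂ => ((cj (F (cj p.1.1) (cj p.2)),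
      F p.1.2 (Q p.1.2 p.1.1 p.2)), cj (G (cj p.1.1) (cj p.2)))) (𝓝 0) (𝓝 0) :=
    ((htc.comp (htF.comp hcc)).prodMk_nhds (htF.comp hzQ)).prodMk_nhds (htc.comp (htG.comp hcc))
  filter_upwards [hσ.eventually hI, hfull.eventually D'.eq_R, hzQ.eventually hGg,
    hcc.eventually hGg] with p h1 h2 h3 h4
  simp only [SegreData.Expanded]
  rw [← h3, h1, h2, h4, cj_mul, cj_cj]

/-- The Jacobian of a local biholomorphism which sends one hypersurface in normal coordinates
into another, and the resulting relation along the Segre variety through the origin. -/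
lemma SendsInto.exists_segre_relation (hQ : IsNormalCoord Q) (hQ' : IsNormalCoord Q')
    (D : SegreData Q) (D' : SegreData Q') (h : SendsInto Q Q' F G) (hJ : JacDet F G ≠ 0) :
    pd G 1 0 0 0 = 0 ∧ pd F 1 0 0 0 ≠ 0 ∧ pd G 0 1 0 0 ≠ 0 ∧
      HasDerivAt (fun χ => cj (F (cj χ) 0)) (cj (pd F 1 0 0 0)) 0 ∧
      ∃ K : ℂ, K ≠ 0 ∧ ∀ᶠ χ in 𝓝[≠] (0 : ℂ), K * D.A (χ, 0) =
        (pd F 1 0 0 0 + pd F 0 1 0 0 * D.s χ) ^ D'.α * D'.A (cj (F (cj χ) 0), 0) := by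
  have hGz := h.eventually_G_zero hQ hQ'
  have hexp := fun g hGg => h.expanded hQ D' (g := g) hGg
  obtain ⟨hF, hG, hF0, hG0, -⟩ := h
  obtain ⟨g, hg, hGg⟩ := hG.exists_eq_last_mul (E := ℂ) hGz
  have hGz1 : pd G 1 0 0 0 = 0 := by
    rw [pd_one_zero, (show (fun z => G z 0) =ᶠ[𝓝 0] fun _ => 0 from hGz).deriv_eq]
    exact deriv_const _ _
  have hL := hF.differentiableAt.hasFDerivAt
  set L := fderiv ℂ (fun p : ℂ × ℂ => F p.1 p.2) 0 with hLdef
  have hFz : HasDerivAt (fun z => F z 0) (L (1, 0)) 0 :=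
    HasFDerivAt.comp_hasDerivAt (f := fun z : ℂ => (z, (0 : ℂ))) 0 hL
      ((hasDerivAt_id (0 : ℂ)).prodMk (hasDerivAt_const _ _))
  have hFw : HasDerivAt (F 0) (L (0, 1)) 0 :=
    HasFDerivAt.comp_hasDerivAt (f := fun w : ℂ => ((0 : ℂ), w)) 0 hL
      ((hasDerivAt_const _ _).prodMk (hasDerivAt_id (0 : ℂ)))
  have ha : pd F 1 0 0 0 = L (1, 0) := hFz.deriv
  have hc : pd F 0 1 0 0 = L (0, 1) := hFw.deriv
  have hb : pd G 0 1 0 0 = g 0 := by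
    have h1 : DifferentiableAt ℂ (fun w => g (0, w)) 0 :=
      (AnalyticAt.comp (f := fun w : ℂ => ((0 : ℂ), w)) hg (by fun_prop)).differentiableAt
    have h2 := (hasDerivAt_id (0 : ℂ)).fun_mul h1.hasDerivAt
    have ht : Tendsto (fun w : ℂ => ((0 : ℂ), w)) (𝓝 0) (𝓝 0) :=
      Continuous.tendsto (by fun_prop) 0
    have h3 := (h2.congr_of_eventuallyEq (f₁ := G 0) (ht.eventually hGg)).deriv
    rw [pd_zero_one, h3]
    simp [Prod.mk_zero_zero]
  rw [JacDet, hGz1, mul_zero, sub_zero] at hJ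
  have ha0 := left_ne_zero_of_mul hJ
  have hb0 := right_ne_zero_of_mul hJ
  have hconj := hFz.cj_cj
  rw [← ha] at hconj
  refine ⟨hGz1, ha0, hb0, hconj, ?_⟩
  rw [ha, hc]
  have hp := hconj.tendsto_nhdsNE (cj_ne_zero ha0)
  rw [cj_zero, hF0, cj_zero] at hp
  have := D.segre_relation hQ D' (F := fun v => F v.1 v.2) (g := g)
    (Fb := fun v => cj (F (cj v.1) (cj v.2))) (gb := fun v => cj (g (cj v.1, cj v.2))) (L := L)
    hF hg (eventually_continuousAt_cj_cj hF) (eventually_continuousAt_cj_cj hg) hF0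
    (by simp [cj_zero, hF0]) (by rwa [hb] at hb0) hL (by rwa [ha] at ha0)
    (by simpa [cj_zero] using hp) (hexp g hGg)
  simpa only [cj_zero] using this

end Jacobian

section Parametrization

lemma eventually_eq_of_pow_eq {l : Filter ℂ} {X Y : ℂ → ℂ} {x : ℂ} {n : ℕ}
    (hX : Tendsto X l (𝓝 x)) (hY : Tendsto Y l (𝓝 x)) (hx : x ≠ 0) (hn : n ≠ 0)
    (h : ∀ᶠ z in l, X z ^ n = Y z ^ n) : ∀ᶠ z in l, X z = Y z := by
  have hS : Tendsto (fun z => ∑ i ∈ Finset.range n, X z ^ i * Y z ^ (n - 1 - i)) l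
      (𝓝 (∑ i ∈ Finset.range n, x ^ i * x ^ (n - 1 - i))) :=
    tendsto_finsetSum _ fun i _ => (hX.pow _).mul (hY.pow _)
  rw [geom_sum₂_self] at hS
  filter_upwards [h, hS.eventually_ne
    (mul_ne_zero (Nat.cast_ne_zero.2 hn) (pow_ne_zero _ hx))] with z h1 h2
  have h3 := (Commute.all (X z) (Y z)).geom_sum₂_mul n
  rw [h1, sub_self] at h3
  exact sub_eq_zero.1 ((mul_eq_zero.1 h3).resolve_left h2)

lemma exists_analyticAt_inverse {v : ℂ → ℂ} (hv : AnalyticAt ℂ v 0) (hv0 : v 0 = 1) :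
    ∃ k : ℂ → ℂ, AnalyticAt ℂ k 0 ∧ k 0 ≠ 0 ∧ ∀ᶠ y in 𝓝 (0 : ℂ), y = y * v y * k (y * v y) := by
  have hφ : AnalyticAt ℂ (fun y => y * v y) 0 := analyticAt_id.mul hv
  have hd : deriv (fun y => y * v y) 0 ≠ 0 := by
    have h := ((hasDerivAt_id (0 : ℂ)).fun_mul hv.differentiableAt.hasDerivAt).deriv
    simp only [id_eq, one_mul, zero_mul, add_zero, hv0] at h
    rw [h]
    exact one_ne_zero
  have hψ := hφ.analyticAt_localInverse hd
  have hinv := HasStrictDerivAt.eventually_left_inverse hφ.hasStrictDerivAt hd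
  set ψ := hφ.hasStrictDerivAt.localInverse _ _ _ hd
  rw [zero_mul] at hψ
  have hψ0 : ψ 0 = 0 := by simpa using hinv.self_of_nhds
  have hk : AnalyticAt ℂ (dslope ψ 0) 0 := by
    obtain ⟨p, hp⟩ := hψ
    exact hp.has_fpower_series_dslope_fslope.analyticAt
  have heq : ∀ᶠ y in 𝓝 (0 : ℂ), y = y * v y * dslope ψ 0 (y * v y) := by
    filter_upwards [hinv] with y hy
    have h := sub_smul_dslope ψ 0 (y * v y)
    rw [sub_zero, hψ0, sub_zero, hy, smul_eq_mul] at h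
    exact h.symm
  refine ⟨_, hk, fun h0 => ?_, heq⟩
  have hc : ContinuousAt (fun y => 1 - v y * dslope ψ 0 (y * v y)) 0 := by
    refine continuousAt_const.sub (hv.continuousAt.mul ?_)
    refine ContinuousAt.comp (f := fun y => y * v y) ?_ hφ.continuousAt
    rw [zero_mul]
    exact hk.continuousAt
  have h1 := hc.eq_zero_of_eventually_punctured (by
    filter_upwards [heq.filter_mono nhdsWithin_le_nhds, self_mem_nhdsWithin] with y h2 h3
    refine (mul_eq_zero.1 (?_ : y * (1 - v y * dslope ψ 0 (y * v y)) = 0)).resolve_left h3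
    linear_combination h2)
  rw [zero_mul, h0, mul_zero, sub_zero] at h1
  exact one_ne_zero h1

variable {Q Q' : ℂ → ℂ → ℂ → ℂ}

/-- Solving the relation along the Segre variety for the factor `y v'(y)`. -/
lemma SegreData.eventually_mul_v_eq (D : SegreData Q) (D' : SegreData Q') {y : ℂ → ℂ}
    {a c d K : ℂ} (hy0 : y 0 = 0) (hy : HasDerivAt y d 0) (hd : d ≠ 0) (ha : a ≠ 0) (hK : K ≠ 0)
    (h : ∀ᶠ χ in 𝓝[≠] (0 : ℂ),
      K * D.A (χ, 0) = (a + c * D.s χ) ^ D'.α * D'.A (y χ, 0)) :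
    ∀ᶠ χ in 𝓝[≠] (0 : ℂ), y χ * D'.v (y χ) =
      χ * (d * D.v χ * (1 + c / a * D.s χ) ^ (-((D'.α : ℂ) / D'.β))) := by
  have hle : 𝓝[≠] (0 : ℂ) ≤ 𝓝 0 := nhdsWithin_le_nhds
  have hf : Tendsto (fun χ => y χ / χ) (𝓝[≠] 0) (𝓝 d) := by
    refine hy.tendsto_slope_zero.congr fun χ => ?_
    simp [hy0, div_eq_inv_mul]
  have hyt : Tendsto y (𝓝 0) (𝓝 0) := by simpa [hy0] using hy.continuousAt.tendsto
  have hv : Tendsto D.v (𝓝[≠] 0) (𝓝 1) := by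
    simpa [D.v_zero] using D.analyticAt_v.continuousAt.tendsto.mono_left hle
  have hv' : Tendsto (fun χ => D'.v (y χ)) (𝓝[≠] 0) (𝓝 1) := by
    have h1 := D'.analyticAt_v.continuousAt.tendsto
    rw [D'.v_zero] at h1
    exact h1.comp (hyt.mono_left hle)
  have hs : Tendsto D.s (𝓝[≠] 0) (𝓝 0) := by
    simpa [D.s_zero] using D.analyticAt_s.continuousAt.tendsto.mono_left hle
  have hX : Tendsto (fun χ => K * D.C * D.v χ ^ D.β) (𝓝[≠] 0) (𝓝 (K * D.C)) := by
    simpa using (hv.pow D.β).const_mul (K * D.C)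
  have hY : Tendsto (fun χ => (a + c * D.s χ) ^ D'.α * (D'.C * (y χ / χ * D'.v (y χ)) ^ D'.β))
      (𝓝[≠] 0) (𝓝 (a ^ D'.α * (D'.C * d ^ D'.β))) := by
    simpa using (((hs.const_mul c).const_add a).pow D'.α).mul
      (((hf.mul hv').pow D'.β).const_mul D'.C)
  obtain ⟨hβ, hC⟩ := eq_of_pow_mul_eq (k := D.β) (l := D'.β) hX hY (mul_ne_zero hK D.C_ne)
    (mul_ne_zero (pow_ne_zero _ ha) (mul_ne_zero D'.C_ne (pow_ne_zero _ hd))) (by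
      filter_upwards [h, D.eq_v.filter_mono hle, (hyt.eventually D'.eq_v).filter_mono hle,
        self_mem_nhdsWithin] with χ h1 h2 h3 h4
      rw [h2, h3] at h1
      have h5 : y χ = χ * (y χ / χ) := (mul_div_cancel₀ _ h4).symm
      have h6 : (y χ * D'.v (y χ)) ^ D'.β = χ ^ D'.β * (y χ / χ * D'.v (y χ)) ^ D'.β := by
        rw [← mul_pow, ← mul_assoc, ← h5]
      rw [h6, mul_pow] at h1
      linear_combination h1)
  have hw : Tendsto (fun χ => 1 + c / a * D.s χ) (𝓝[≠] 0) (𝓝 1) := by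
    simpa using (hs.const_mul (c / a)).const_add 1
  have hρ : Tendsto (fun χ => (1 + c / a * D.s χ) ^ (-((D'.α : ℂ) / D'.β))) (𝓝[≠] 0) (𝓝 1) := by
    simpa using hw.cpow (tendsto_const_nhds (x := -((D'.α : ℂ) / D'.β)))
      Complex.one_mem_slitPlane
  have hroot := eventually_eq_of_pow_eq (n := D'.β) (x := d)
    (X := fun χ => y χ / χ * D'.v (y χ))
    (Y := fun χ => d * D.v χ * (1 + c / a * D.s χ) ^ (-((D'.α : ℂ) / D'.β)))
    (l := 𝓝[≠] 0) (by simpa using hf.mul hv')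
    (by simpa using (hv.const_mul d).mul hρ) hd D'.β_ne (by
      filter_upwards [h, D.eq_v.filter_mono hle, (hyt.eventually D'.eq_v).filter_mono hle,
        hw.eventually_ne one_ne_zero, self_mem_nhdsWithin] with χ h1 h2 h3 h4 h7
      have h7' : χ ≠ 0 := h7
      rw [h2, h3, hβ] at h1
      have h5 : y χ = χ * (y χ / χ) := (mul_div_cancel₀ _ h7').symm
      have h6 : (y χ * D'.v (y χ)) ^ D'.β = χ ^ D'.β * (y χ / χ * D'.v (y χ)) ^ D'.β := by
        rw [← mul_pow, ← mul_assoc, ← h5]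
      rw [h6, mul_pow] at h1
      have h8 : a + c * D.s χ = a * (1 + c / a * D.s χ) := by field_simp
      have h9 : ((1 + c / a * D.s χ) ^ (-((D'.α : ℂ) / D'.β))) ^ D'.β *
          (1 + c / a * D.s χ) ^ D'.α = 1 := by
        have hβ0 : (D'.β : ℂ) ≠ 0 := Nat.cast_ne_zero.2 D'.β_ne
        rw [← Complex.cpow_mul_nat, neg_mul, div_mul_cancel₀ _ hβ0, Complex.cpow_neg,
          Complex.cpow_natCast]
        exact inv_mul_cancel₀ (pow_ne_zero _ h4)
      rw [h8, mul_pow] at h1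
      rw [mul_pow, mul_pow (d * D.v χ), mul_pow d]
      generalize ((1 + c / a * D.s χ) ^ (-((D'.α : ℂ) / D'.β))) ^ D'.β = r at *
      generalize (1 + c / a * D.s χ) ^ D'.α = w at *
      have hP : χ ^ D'.β * (a ^ D'.α * D'.C) ≠ 0 :=
        mul_ne_zero (pow_ne_zero _ h7') (mul_ne_zero (pow_ne_zero _ ha) D'.C_ne)
      refine mul_left_cancel₀ hP ?_
      rw [mul_pow (y χ / χ)] at h1
      linear_combination (-r) * h1 + r * χ ^ D'.β * D.v χ ^ D'.β * hC -
        χ ^ D'.β * a ^ D'.α * D'.C * ((y χ / χ) ^ D'.β * D'.v (y χ) ^ D'.β) * h9)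
  filter_upwards [hroot, self_mem_nhdsWithin] with χ h1 h2
  rw [← h1, ← mul_assoc, mul_div_cancel₀ _ h2]

end Parametrization

/-- identity (22): there is a holomorphic function `Ψ(χ, Λ, Λ̃)` on a
neighborhood `V` of `{0} × T(ℂ²) × conj(T(ℂ²))`, depending only on `Q, Q'`, nonvanishing
at `χ = 0` on `T(ℂ²) × conj(T(ℂ²))`, such that every local biholomorphism `H = (F, G)`
sending `M` into `M'` satisfies `F̄(χ, 0) = χ · Ψ(χ, H'(0), conj H'(0))` for `χ` near `0`. -/
theorem F_along_segre_parametrization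
    (Q Q' : ℂ → ℂ → ℂ → ℂ) (hQ : IsNormalCoord Q) (hQ' : IsNormalCoord Q')
    (hLF : NotLeviFlat Q) (hLF' : NotLeviFlat Q') :
    ∃ (V : Set (ℂ × Matrix (Fin 2) (Fin 2) ℂ × Matrix (Fin 2) (Fin 2) ℂ))
      (Ψ : ℂ × Matrix (Fin 2) (Fin 2) ℂ × Matrix (Fin 2) (Fin 2) ℂ → ℂ),
      IsOpen V ∧
      (∀ A B : Matrix (Fin 2) (Fin 2) ℂ, A ∈ Tmat → B ∈ TmatConj → ((0 : ℂ), A, B) ∈ V) ∧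
      AnalyticOnNhd ℂ Ψ V ∧
      (∀ A B : Matrix (Fin 2) (Fin 2) ℂ, A ∈ Tmat → B ∈ TmatConj → Ψ (0, A, B) ≠ 0) ∧
      ∀ F G : ℂ → ℂ → ℂ, SendsInto Q Q' F G → JacDet F G ≠ 0 →
        ∀ᶠ χ : ℂ in 𝓝 0,
          (χ, Jmat F G, (Jmat F G).map cj) ∈ V ∧
          cj (F (cj χ) 0) = χ * Ψ (χ, Jmat F G, (Jmat F G).map cj) := by
  obtain ⟨D⟩ := hQ.nonempty_segreData hLF
  obtain ⟨D'⟩ := hQ'.nonempty_segreData hLF'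
  obtain ⟨k, hk, hk0, hkv⟩ := exists_analyticAt_inverse D'.analyticAt_v D'.v_zero
  let t : ℂ × Matrix (Fin 2) (Fin 2) ℂ × Matrix (Fin 2) (Fin 2) ℂ → ℂ := fun p =>
    p.2.2 0 0 * D.v p.1 *
      (1 + p.2.1 0 1 / p.2.1 0 0 * D.s p.1) ^ (-((D'.α : ℂ) / D'.β))
  let Ψ : ℂ × Matrix (Fin 2) (Fin 2) ℂ × Matrix (Fin 2) (Fin 2) ℂ → ℂ := fun p =>
    t p * k (p.1 * t p)
  have hΨ : ∀ A B : Matrix (Fin 2) (Fin 2) ℂ, A ∈ Tmat → AnalyticAt ℂ Ψ (0, A, B) := by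
    intro A B hA
    have hfst : AnalyticAt ℂ (fun p : ℂ × Matrix (Fin 2) (Fin 2) ℂ × Matrix (Fin 2) (Fin 2) ℂ =>
        p.1) (0, A, B) := analyticAt_fst
    have hentry : ∀ i j, AnalyticAt ℂ
        (fun p : ℂ × Matrix (Fin 2) (Fin 2) ℂ × Matrix (Fin 2) (Fin 2) ℂ => p.2.1 i j)
        (0, A, B) := fun i j =>
      ((LinearMap.toContinuousLinearMap (Matrix.entryLinearMap ℂ ℂ i j)).comp
        ((ContinuousLinearMap.fst ℂ (Matrix (Fin 2) (Fin 2) ℂ) (Matrix (Fin 2) (Fin 2) ℂ)).comp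
          (ContinuousLinearMap.snd ℂ ℂ _))).analyticAt (0, A, B)
    have hentry' : AnalyticAt ℂ
        (fun p : ℂ × Matrix (Fin 2) (Fin 2) ℂ × Matrix (Fin 2) (Fin 2) ℂ => p.2.2 0 0)
        (0, A, B) :=
      ((LinearMap.toContinuousLinearMap (Matrix.entryLinearMap ℂ ℂ 0 0)).comp
        ((ContinuousLinearMap.snd ℂ (Matrix (Fin 2) (Fin 2) ℂ) (Matrix (Fin 2) (Fin 2) ℂ)).comp
          (ContinuousLinearMap.snd ℂ ℂ _))).analyticAt (0, A, B)
    have ht : AnalyticAt ℂ t (0, A, B) := by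
      refine (hentry'.mul (AnalyticAt.comp D.analyticAt_v hfst)).mul (AnalyticAt.cpow
        (analyticAt_const.add (((hentry 0 1).div (hentry 0 0) hA.2.1).mul
          (AnalyticAt.comp D.analyticAt_s hfst))) analyticAt_const ?_)
      simp [D.s_zero]
    refine ht.mul (AnalyticAt.comp
      (f := fun p : ℂ × Matrix (Fin 2) (Fin 2) ℂ × Matrix (Fin 2) (Fin 2) ℂ => p.1 * t p)
      ?_ (hfst.mul ht))
    simpa using hk
  refine ⟨{p | AnalyticAt ℂ Ψ p}, Ψ, isOpen_analyticAt ℂ Ψ, fun A B hA _ => hΨ A B hA,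
    fun p hp => hp, ?_, ?_⟩
  · rintro A _ hA ⟨B, hB, rfl⟩
    simp only [Ψ, t, D.v_zero, D.s_zero, zero_mul, mul_zero, add_zero, mul_one, Complex.one_cpow,
      Matrix.map_apply]
    exact mul_ne_zero (cj_ne_zero hB.2.1) hk0
  · intro F G hS hJ
    obtain ⟨hG1, ha, hb, hd, K, hK, hrel⟩ := hS.exists_segre_relation hQ hQ' D D' hJ
    have hy0 : cj (F (cj 0) 0) = 0 := by rw [cj_zero, hS.2.2.1, cj_zero]
    have hTmat : Jmat F G ∈ Tmat := by
      refine ⟨?_, ?_, ?_⟩ <;> simpa [Jmat]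
    have hcurve : Continuous fun χ : ℂ => (χ, Jmat F G, (Jmat F G).map cj) := by fun_prop
    refine (hcurve.continuousAt.eventually_mem
      ((isOpen_analyticAt ℂ Ψ).mem_nhds (hΨ _ _ hTmat))).and ?_
    have hmul := D.eventually_mul_v_eq D' hy0 hd (cj_ne_zero ha) ha hK hrel
    have hyt : Tendsto (fun χ => cj (F (cj χ) 0)) (𝓝 0) (𝓝 0) := by
      have h := hd.continuousAt.tendsto
      rwa [hy0] at h
    rw [eventually_nhdsWithin_iff] at hmul
    filter_upwards [hmul, hyt.eventually hkv] with χ h1 h2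
    rcases eq_or_ne χ 0 with rfl | hχ
    · rw [hy0, zero_mul]
    · have h3 : cj (F (cj χ) 0) * D'.v (cj (F (cj χ) 0)) =
          χ * t (χ, Jmat F G, (Jmat F G).map cj) := h1 hχ
      rw [h3] at h2
      rw [h2, mul_assoc]
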